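/- arXiv:1005.3942 — 2 statements merged into one kernel-verified Lean document; each statement's English description precedes it below -/
import Mathlib

section
/- Let λ ∈ ℝ and let u, h_i, h_j : ℝ × ℝ → ℝ be smooth functions, 2π-periodic in x, with h_i and h_j everywhere strictly positive, satisfying h_{i,t} = λ (h_i u)_x and h_{j,t} = λ (h_j u)_x for all (x,t). Then for every n ∈ ℕ the functional H(t) = ∫₀^{2π} h_i(x,t)^{2^n} h_j(x,t)^{1 - 2^n} dx is constant in t. -/
/-- Partial derivative in the first (space) variable. -/
noncomputable def pdx (f : ℝ → ℝ → ℝ) : ℝ → ℝ → ℝ := fun x t => deriv (fun y => f y t) x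

/-- Partial derivative in the second (time) variable. -/
noncomputable def pdt (f : ℝ → ℝ → ℝ) : ℝ → ℝ → ℝ := fun x t => deriv (fun s => f x s) t

/-- Smoothness of a function of two real variables. -/
def Smooth2 (f : ℝ → ℝ → ℝ) : Prop := ContDiff ℝ (⊤ : ℕ∞) (fun p : ℝ × ℝ => f p.1 p.2)

theorem Smooth2.hasDerivAt_pdx {f : ℝ → ℝ → ℝ} (hf : Smooth2 f) (x t : ℝ) :
    HasDerivAt (fun y => f y t) (pdx f x t) x := by
  have h : ContDiff ℝ (⊤ : ℕ∞) (fun y => f y t) :=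
    ContDiff.comp (g := fun p : ℝ × ℝ => f p.1 p.2) hf (contDiff_id.prodMk contDiff_const)
  exact (h.differentiable (by simp) x).hasDerivAt

theorem Smooth2.hasDerivAt_pdt {f : ℝ → ℝ → ℝ} (hf : Smooth2 f) (x t : ℝ) :
    HasDerivAt (fun s => f x s) (pdt f x t) t := by
  have h : ContDiff ℝ (⊤ : ℕ∞) (fun s => f x s) :=
    ContDiff.comp (g := fun p : ℝ × ℝ => f p.1 p.2) hf (contDiff_const.prodMk contDiff_id)
  exact (h.differentiable (by simp) t).hasDerivAt

theorem Smooth2.continuous_pdx {f : ℝ → ℝ → ℝ} (hf : Smooth2 f) :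
    Continuous (fun p : ℝ × ℝ => pdx f p.1 p.2) := by
  have h : (fun p : ℝ × ℝ => pdx f p.1 p.2) =
      fun p => fderiv ℝ (fun q : ℝ × ℝ => f q.1 q.2) p (1, 0) := by
    ext ⟨x, t⟩
    have hd := (ContDiff.differentiable hf (by simp) (x, t)).hasFDerivAt
    have hc : HasDerivAt (fun y : ℝ => (y, t)) ((1 : ℝ), (0 : ℝ)) x :=
      (hasDerivAt_id x).prodMk (hasDerivAt_const x t)
    exact (hd.comp_hasDerivAt x hc).deriv
  rw [h]
  exact (ContDiff.continuous_fderiv hf (by simp)).clm_apply continuous_const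

theorem Smooth2.mul {f g : ℝ → ℝ → ℝ} (hf : Smooth2 f) (hg : Smooth2 g) :
    Smooth2 (fun x t => f x t * g x t) :=
  ContDiff.mul hf hg

theorem Smooth2.rpow_const {f : ℝ → ℝ → ℝ} (hf : Smooth2 f) (hpos : ∀ x t, 0 < f x t) (a : ℝ) :
    Smooth2 (fun x t => f x t ^ a) :=
  ContDiff.rpow_const_of_ne hf fun p => ne_of_gt (hpos p.1 p.2)

/-- A density `g` satisfying a conservation law `g_t = λ F_x` with periodic flux has conserved
integral over a period. -/
theorem integral_eq_of_conservation_law {lam T : ℝ} {g F : ℝ → ℝ → ℝ}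
    (hg : Smooth2 g) (hF : Smooth2 F) (hper : ∀ t, Function.Periodic (fun x => F x t) T)
    (heq : ∀ x t, pdt g x t = lam * pdx F x t) (t₁ t₂ : ℝ) :
    ∫ x in (0:ℝ)..T, g x t₁ = ∫ x in (0:ℝ)..T, g x t₂ := by
  have hcont : Continuous (fun p : ℝ × ℝ => lam * pdx F p.1 p.2) :=
    continuous_const.mul hF.continuous_pdx
  have hgc (t : ℝ) : Continuous fun x => g x t :=
    (ContDiff.continuous hg).comp (by fun_prop : Continuous fun x : ℝ => (x, t))
  have htime (x : ℝ) : ∫ t in t₁..t₂, lam * pdx F x t = g x t₂ - g x t₁ :=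
    intervalIntegral.integral_eq_sub_of_hasDerivAt
      (fun t _ => heq x t ▸ hg.hasDerivAt_pdt x t)
      ((hcont.comp (by fun_prop : Continuous fun t : ℝ => (x, t))).intervalIntegrable _ _)
  have hspace (t : ℝ) : ∫ x in (0:ℝ)..T, lam * pdx F x t = 0 := by
    rw [intervalIntegral.integral_eq_sub_of_hasDerivAt
      (fun x _ => (hF.hasDerivAt_pdx x t).const_mul lam)
      ((hcont.comp (by fun_prop : Continuous fun x : ℝ => (x, t))).intervalIntegrable _ _)]
    have h := hper t 0
    simp only [zero_add] at h
    rw [h, sub_self]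
  have hswap : ∫ x in (0:ℝ)..T, ∫ t in t₁..t₂, lam * pdx F x t =
      ∫ t in t₁..t₂, ∫ x in (0:ℝ)..T, lam * pdx F x t :=
    MeasureTheory.intervalIntegral_intervalIntegral_swap <|
      (hcont.continuousOn.integrableOn_compact (isCompact_uIcc.prod isCompact_uIcc)).mono_set
        (Set.prod_mono Set.uIoc_subset_uIcc Set.uIoc_subset_uIcc)
  simp only [htime, hspace, intervalIntegral.integral_zero] at hswap
  rw [intervalIntegral.integral_sub ((hgc t₂).intervalIntegrable _ _)
    ((hgc t₁).intervalIntegrable _ _)] at hswap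
  linarith

/-- If `h` and `k` are positive densities transported by `u`, so is `h ^ a * k ^ (1 - a)`. -/
theorem pdt_rpow_mul_rpow {lam : ℝ} {u h k : ℝ → ℝ → ℝ}
    (hu : Smooth2 u) (hh : Smooth2 h) (hk : Smooth2 k)
    (hpos : ∀ x t, 0 < h x t) (kpos : ∀ x t, 0 < k x t)
    (hEq : ∀ x t, pdt h x t = lam * pdx (fun x t => h x t * u x t) x t)
    (kEq : ∀ x t, pdt k x t = lam * pdx (fun x t => k x t * u x t) x t) (a x t : ℝ) :
    pdt (fun x t => h x t ^ a * k x t ^ (1 - a)) x t =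
      lam * pdx (fun x t => h x t ^ a * k x t ^ (1 - a) * u x t) x t := by
  have h0 := (hpos x t).ne'
  have k0 := (kpos x t).ne'
  have hx := hh.hasDerivAt_pdx x t
  have kx := hk.hasDerivAt_pdx x t
  have ux := hu.hasDerivAt_pdx x t
  have e1 : pdt h x t = lam * (pdx h x t * u x t + h x t * pdx u x t) :=
    (hEq x t).trans (congrArg _ (hx.mul ux).deriv)
  have e2 : pdt k x t = lam * (pdx k x t * u x t + k x t * pdx u x t) :=
    (kEq x t).trans (congrArg _ (kx.mul ux).deriv)
  have dt := (((hh.hasDerivAt_pdt x t).rpow_const (p := a) (Or.inl h0)).mul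
    ((hk.hasDerivAt_pdt x t).rpow_const (p := 1 - a) (Or.inl k0))).deriv
  have dx := (((hx.rpow_const (p := a) (Or.inl h0)).mul
    (kx.rpow_const (p := 1 - a) (Or.inl k0))).mul ux).deriv
  refine dt.trans (Eq.trans ?_ (congrArg _ dx.symm))
  simp only [Pi.mul_apply]
  rw [e1, e2, Real.rpow_sub_one h0, Real.rpow_sub_one k0]
  field_simp
  ring

/-- Remark 2 of the paper. If `h_i` and `h_j` both satisfy
`h_t = λ (h u)_x` and are strictly positive, then for every `n ∈ ℕ` the functional
`∫₀^{2π} h_i^{2ⁿ} h_j^{1-2ⁿ} dx` is conserved. -/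
theorem statement3 (lam : ℝ) (u hi hj : ℝ → ℝ → ℝ)
    (hu : Smooth2 u) (hhi : Smooth2 hi) (hhj : Smooth2 hj)
    (huper : ∀ t, Function.Periodic (fun x => u x t) (2 * Real.pi))
    (hiper : ∀ t, Function.Periodic (fun x => hi x t) (2 * Real.pi))
    (hjper : ∀ t, Function.Periodic (fun x => hj x t) (2 * Real.pi))
    (hipos : ∀ x t, 0 < hi x t) (hjpos : ∀ x t, 0 < hj x t)
    (hiEq : ∀ x t, pdt hi x t = lam * pdx (fun x t => hi x t * u x t) x t)
    (hjEq : ∀ x t, pdt hj x t = lam * pdx (fun x t => hj x t * u x t) x t) :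
    ∀ (n : ℕ) (t₁ t₂ : ℝ),
      (∫ x in (0:ℝ)..(2 * Real.pi), hi x t₁ ^ ((2:ℝ) ^ n) * hj x t₁ ^ (1 - (2:ℝ) ^ n))
        = ∫ x in (0:ℝ)..(2 * Real.pi), hi x t₂ ^ ((2:ℝ) ^ n) * hj x t₂ ^ (1 - (2:ℝ) ^ n) := by
  intro n t₁ t₂
  have hg := (hhi.rpow_const hipos ((2:ℝ) ^ n)).mul (hhj.rpow_const hjpos (1 - (2:ℝ) ^ n))
  refine integral_eq_of_conservation_law hg (hg.mul hu) (fun t x => ?_)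
    (pdt_rpow_mul_rpow hu hhi hhj hipos hjpos hiEq hjEq _) t₁ t₂
  have hi_per := hiper t x
  have hj_per := hjper t x
  have hu_per := huper t x
  simp only at hi_per hj_per hu_per ⊢
  rw [hi_per, hj_per, hu_per]
end

section
/- Let u, v, z : ℝ × ℝ → ℝ be smooth functions satisfying u_t = v - u u_x, v_t = z - u v_x, z_t = -u z_x, and let r : ℝ × ℝ → ℝ be a smooth function satisfying D_t r + u_x r = 1 with D_t = ∂_t + u ∂_x. Let λ ∈ ℝ. Define the 3×3 matrix-valued functions ℓ with rows (λ u_x, -v_x, z_x), (3λ², -2λ u_x, λ v_x), (6λ² r, -3λ, λ u_x); q with q₂₁ = λ, q₃₂ = 1 and all other entries zero; and p = -u·ℓ + q. Then the zero-curvature condition ∂_t ℓ - ∂_x p + ℓ p - p ℓ = 0 holds identically, entrywise, at every point (x,t). -/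
/-- The spatial Lax matrix `ℓ[u,v,z;λ]` for the `N = 3` Riemann type system. -/
noncomputable def laxL3 (u v z r : ℝ → ℝ → ℝ) (lam : ℝ) (x t : ℝ) :
    Matrix (Fin 3) (Fin 3) ℝ :=
  !![lam * pdx u x t, -pdx v x t, pdx z x t;
     3 * lam ^ 2, -2 * lam * pdx u x t, lam * pdx v x t;
     6 * lam ^ 2 * r x t, -3 * lam, lam * pdx u x t]

/-- The constant matrix `q(λ)` for the `N = 3` Riemann type system. -/
noncomputable def laxQ3 (lam : ℝ) : Matrix (Fin 3) (Fin 3) ℝ :=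
  !![0, 0, 0; lam, 0, 0; 0, 1, 0]

/-- The temporal Lax matrix `p(ℓ) = -u ℓ + q(λ)`. -/
noncomputable def laxP3 (u v z r : ℝ → ℝ → ℝ) (lam : ℝ) (x t : ℝ) :
    Matrix (Fin 3) (Fin 3) ℝ :=
  (-(u x t)) • laxL3 u v z r lam x t + laxQ3 lam

namespace Smooth2

variable {f : ℝ → ℝ → ℝ}

theorem contDiff (hf : Smooth2 f) :
    ContDiff ℝ (⊤ : ℕ∞) (fun p : ℝ × ℝ => f p.1 p.2) := hf

theorem hasFDerivAt (hf : Smooth2 f) (p : ℝ × ℝ) :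
    HasFDerivAt (fun p : ℝ × ℝ => f p.1 p.2) (fderiv ℝ (fun p : ℝ × ℝ => f p.1 p.2) p) p :=
  (hf.contDiff.differentiable (by simp) p).hasFDerivAt

theorem hasDerivAt_fderiv_fst (hf : Smooth2 f) (x t : ℝ) :
    HasDerivAt (fun y => f y t) (fderiv ℝ (fun p : ℝ × ℝ => f p.1 p.2) (x, t) (1, 0)) x :=
  (hf.hasFDerivAt (x, t)).comp_hasDerivAt (f := fun y => (y, t)) x
    ((hasDerivAt_id x).prodMk (hasDerivAt_const x t))

theorem hasDerivAt_fderiv_snd (hf : Smooth2 f) (x t : ℝ) :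
    HasDerivAt (fun s => f x s) (fderiv ℝ (fun p : ℝ × ℝ => f p.1 p.2) (x, t) (0, 1)) t :=
  (hf.hasFDerivAt (x, t)).comp_hasDerivAt (f := fun s => (x, s)) t
    ((hasDerivAt_const t x).prodMk (hasDerivAt_id t))

theorem pdx_eq_fderiv (hf : Smooth2 f) (x t : ℝ) :
    pdx f x t = fderiv ℝ (fun p : ℝ × ℝ => f p.1 p.2) (x, t) (1, 0) :=
  (hf.hasDerivAt_fderiv_fst x t).deriv

theorem pdt_eq_fderiv (hf : Smooth2 f) (x t : ℝ) :
    pdt f x t = fderiv ℝ (fun p : ℝ × ℝ => f p.1 p.2) (x, t) (0, 1) :=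
  (hf.hasDerivAt_fderiv_snd x t).deriv

theorem hasDerivAt_pdx_s14 (hf : Smooth2 f) (x t : ℝ) :
    HasDerivAt (fun y => f y t) (pdx f x t) x :=
  (hf.hasDerivAt_fderiv_fst x t).differentiableAt.hasDerivAt

theorem hasDerivAt_pdt_s14 (hf : Smooth2 f) (x t : ℝ) :
    HasDerivAt (fun s => f x s) (pdt f x t) t :=
  (hf.hasDerivAt_fderiv_snd x t).differentiableAt.hasDerivAt

theorem contDiff_fderiv (hf : Smooth2 f) :
    ContDiff ℝ (⊤ : ℕ∞) (fderiv ℝ (fun p : ℝ × ℝ => f p.1 p.2)) :=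
  hf.contDiff.fderiv_right (by simp)

theorem smooth2_pdx (hf : Smooth2 f) : Smooth2 (pdx f) := by
  simpa only [Smooth2, hf.pdx_eq_fderiv] using hf.contDiff_fderiv.clm_apply contDiff_const

/-- Mixed partial derivatives of a smooth function commute. -/
theorem pdt_pdx (hf : Smooth2 f) (x t : ℝ) : pdt (pdx f) x t = pdx (pdt f) x t := by
  have hd : HasFDerivAt (fderiv ℝ (fun p : ℝ × ℝ => f p.1 p.2))
      (fderiv ℝ (fderiv ℝ (fun p : ℝ × ℝ => f p.1 p.2)) (x, t)) (x, t) :=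
    (hf.contDiff_fderiv.differentiable (by simp) (x, t)).hasFDerivAt
  have hxt := ((hd.comp_hasDerivAt (f := fun s => (x, s)) t
    ((hasDerivAt_const t x).prodMk (hasDerivAt_id t))).clm_apply
      (hasDerivAt_const t ((1, 0) : ℝ × ℝ)))
  have htx := ((hd.comp_hasDerivAt (f := fun y => (y, t)) x
    ((hasDerivAt_id x).prodMk (hasDerivAt_const x t))).clm_apply
      (hasDerivAt_const x ((0, 1) : ℝ × ℝ)))
  have hsymm := second_derivative_symmetric hf.hasFDerivAt hd (0, 1) (1, 0)
  simp only [map_zero, add_zero, Function.comp_def] at hxt htx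
  rw [pdt, pdx]
  simp only [hf.pdx_eq_fderiv, hf.pdt_eq_fderiv]
  rw [hxt.deriv, htx.deriv, hsymm]

end Smooth2

/-- the zero-curvature (Lax compatibility) condition
`∂_t ℓ - ∂_x p + ℓ p - p ℓ = 0` holds entrywise for the `N = 3` Riemann type
system `u_t = v - u u_x`, `v_t = z - u v_x`, `z_t = -u z_x`, provided
`r` satisfies `D_t r + u_x r = 1`. -/
theorem statement14 (u v z r : ℝ → ℝ → ℝ) (lam : ℝ)
    (hu : Smooth2 u) (hv : Smooth2 v) (hz : Smooth2 z) (hr : Smooth2 r)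
    (sys1 : ∀ x t, pdt u x t = v x t - u x t * pdx u x t)
    (sys2 : ∀ x t, pdt v x t = z x t - u x t * pdx v x t)
    (sys3 : ∀ x t, pdt z x t = -(u x t) * pdx z x t)
    (hrEq : ∀ x t, pdt r x t + u x t * pdx r x t + pdx u x t * r x t = 1) :
    ∀ (x t : ℝ) (i j : Fin 3),
      deriv (fun s => laxL3 u v z r lam x s i j) t
        - deriv (fun y => laxP3 u v z r lam y t i j) x
        + ((laxL3 u v z r lam x t * laxP3 u v z r lam x t) i j
            - (laxP3 u v z r lam x t * laxL3 u v z r lam x t) i j) = 0 := by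
  intro x t i j
  have hmul {f : ℝ → ℝ → ℝ} (hf : Smooth2 f) :
      HasDerivAt (fun y => u y t * pdx f y t)
        (pdx u x t * pdx f x t + u x t * pdx (pdx f) x t) x :=
    (hu.hasDerivAt_pdx_s14 x t).mul (hf.smooth2_pdx.hasDerivAt_pdx_s14 x t)
  have hut : pdt (pdx u) x t =
      pdx v x t - (pdx u x t * pdx u x t + u x t * pdx (pdx u) x t) := by
    rw [hu.pdt_pdx, pdx]
    simp only [sys1]
    exact ((hv.hasDerivAt_pdx_s14 x t).sub (hmul hu)).deriv
  have hvt : pdt (pdx v) x t =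
      pdx z x t - (pdx u x t * pdx v x t + u x t * pdx (pdx v) x t) := by
    rw [hv.pdt_pdx, pdx]
    simp only [sys2]
    exact ((hz.hasDerivAt_pdx_s14 x t).sub (hmul hv)).deriv
  have hzt : pdt (pdx z) x t =
      -(pdx u x t * pdx z x t + u x t * pdx (pdx z) x t) := by
    rw [hz.pdt_pdx, pdx]
    simp only [sys3, neg_mul]
    exact (hmul hz).neg.deriv
  let L (a b c d : ℝ) : Matrix (Fin 3) (Fin 3) ℝ :=
    !![lam * a, -b, c; 0, -2 * lam * a, lam * b; 6 * lam ^ 2 * d, 0, lam * a]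
  have hLt : HasDerivAt (fun s => laxL3 u v z r lam x s i j)
      (L (pdt (pdx u) x t) (pdt (pdx v) x t) (pdt (pdx z) x t) (pdt r x t) i j) t := by
    have h1 := hu.smooth2_pdx.hasDerivAt_pdt_s14 x t
    have h2 := hv.smooth2_pdx.hasDerivAt_pdt_s14 x t
    have h3 := hz.smooth2_pdx.hasDerivAt_pdt_s14 x t
    have h4 := hr.hasDerivAt_pdt_s14 x t
    fin_cases i <;> fin_cases j <;>
      first
      | exact h1.const_mul _
      | exact h2.const_mul _
      | exact h2.neg
      | exact h3
      | exact h4.const_mul _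
      | exact hasDerivAt_const _ _
  have hLx : HasDerivAt (fun y => laxL3 u v z r lam y t i j)
      (L (pdx (pdx u) x t) (pdx (pdx v) x t) (pdx (pdx z) x t) (pdx r x t) i j) x := by
    have h1 := hu.smooth2_pdx.hasDerivAt_pdx_s14 x t
    have h2 := hv.smooth2_pdx.hasDerivAt_pdx_s14 x t
    have h3 := hz.smooth2_pdx.hasDerivAt_pdx_s14 x t
    have h4 := hr.hasDerivAt_pdx_s14 x t
    fin_cases i <;> fin_cases j <;>
      first
      | exact h1.const_mul _
      | exact h2.const_mul _
      | exact h2.neg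
      | exact h3
      | exact h4.const_mul _
      | exact hasDerivAt_const _ _
  have hPx : HasDerivAt (fun y => laxP3 u v z r lam y t i j)
      (-pdx u x t * laxL3 u v z r lam x t i j + -u x t *
        L (pdx (pdx u) x t) (pdx (pdx v) x t) (pdx (pdx z) x t) (pdx r x t) i j) x :=
    (((hu.hasDerivAt_pdx_s14 x t).neg.mul hLx).add_const (laxQ3 lam i j))
  rw [hLt.deriv, hPx.deriv, hut, hvt, hzt]
  have hr' := hrEq x t
  fin_cases i <;> fin_cases j <;>
    simp [L, laxP3, laxL3, laxQ3, Matrix.mul_apply, Fin.sum_univ_three] <;>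
    first
    | ring1
    | linear_combination 6 * lam ^ 2 * hr'
end
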